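/- arXiv:1203.4618 — 5 statements merged into one kernel-verified Lean document; each statement's English description precedes it below -/
import Mathlib

section
/- ∫_0^1 ln(1+x²)/(1+x²) dx = (π/2) ln 2 − G, where G is Catalan's constant. -/
open Real

/-- Catalan's constant `G = ∑_{k=0}^∞ (-1)^k / (2k+1)^2`. -/
noncomputable def catalanG : ℝ := ∑' k : ℕ, (-1 : ℝ) ^ k / (2 * (k : ℝ) + 1) ^ 2

open MeasureTheory Set

theorem continuous_dslope_arctan : Continuous (dslope arctan 0) := by
  rw [← continuousOn_univ, continuousOn_dslope Filter.univ_mem]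
  exact ⟨continuous_arctan.continuousOn, differentiable_arctan 0⟩

theorem mul_dslope_arctan (x : ℝ) : x * dslope arctan 0 x = arctan x := by
  simpa using sub_smul_dslope arctan 0 x

theorem hasSum_dslope_arctan {x : ℝ} (hx : x ∈ Ioo (0 : ℝ) 1) :
    HasSum (fun k : ℕ => (-1) ^ k * x ^ (2 * k) / (2 * (k : ℝ) + 1)) (dslope arctan 0 x) := by
  have hx1 : ‖x‖ < 1 := by
    rw [norm_eq_abs, abs_of_pos hx.1]
    exact hx.2
  have h := (hasSum_arctan hx1).mul_left x⁻¹
  rw [← mul_dslope_arctan, inv_mul_cancel_left₀ hx.1.ne'] at h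
  refine h.congr_fun fun k => ?_
  have := hx.1.ne'
  push_cast
  field_simp
  ring

theorem summable_one_div_odd_sq : Summable fun k : ℕ => 1 / (2 * (k : ℝ) + 1) ^ 2 := by
  have h : Summable fun k : ℕ => 1 / ((k : ℝ)) ^ 2 := summable_one_div_nat_pow.2 one_lt_two
  have := h.comp_injective (i := fun k : ℕ => 2 * k + 1) fun a b hab => by simpa using hab
  simpa [Function.comp_def] using this

theorem integral_dslope_arctan : ∫ x in (0 : ℝ)..1, dslope arctan 0 x = catalanG := by
  have hint (k : ℕ) (c : ℝ) : ∫ x in Ioo (0 : ℝ) 1, c * x ^ (2 * k) / (2 * (k : ℝ) + 1) =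
      c / (2 * (k : ℝ) + 1) ^ 2 := by
    rw [← integral_Ioc_eq_integral_Ioo, ← intervalIntegral.integral_of_le zero_le_one,
      intervalIntegral.integral_div, intervalIntegral.integral_const_mul, integral_pow]
    have : (2 * (k : ℝ) + 1) ≠ 0 := by positivity
    push_cast
    field_simp
    simp
  have key := hasSum_integral_of_summable_integral_norm
    (μ := volume.restrict (Ioo (0 : ℝ) 1))
    (F := fun (k : ℕ) (x : ℝ) => (-1) ^ k * x ^ (2 * k) / (2 * (k : ℝ) + 1))
    (fun k => ((by fun_prop : Continuous fun x : ℝ =>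
      (-1) ^ k * x ^ (2 * k) / (2 * (k : ℝ) + 1)).integrableOn_Icc).mono_set Ioo_subset_Icc_self)
    (by
      refine summable_one_div_odd_sq.congr fun k => ?_
      rw [← hint k 1]
      refine setIntegral_congr_fun measurableSet_Ioo fun x hx => ?_
      have h1 : 0 < 2 * (k : ℝ) + 1 := by positivity
      simp [abs_of_pos hx.1, abs_of_pos h1])
  rw [setIntegral_congr_fun measurableSet_Ioo fun x hx => (hasSum_dslope_arctan hx).tsum_eq] at key
  simp only [hint] at key
  rw [intervalIntegral.integral_of_le zero_le_one, integral_Ioc_eq_integral_Ioo, catalanG,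
    key.tsum_eq]

theorem cos_pos_of_mem_Icc {t : ℝ} (ht : t ∈ Icc 0 (π / 4)) : 0 < cos t :=
  cos_pos_of_mem_Ioo ⟨by linarith [ht.1, pi_pos], by linarith [ht.2, pi_pos]⟩

theorem integral_log_sin_sub_log_cos :
    ∫ t in (0 : ℝ)..(π / 4), (log (sin t) - log (cos t)) = -catalanG := by
  have hderiv (t : ℝ) (ht : t ∈ Ioo 0 (π / 4)) :
      HasDerivAt (fun t => t * log (tan t) - ∫ s in (0 : ℝ)..(tan t), dslope arctan 0 s)
        (log (sin t) - log (cos t)) t := by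
    have hc := cos_pos_of_mem_Icc (Ioo_subset_Icc_self ht)
    have hs : 0 < sin t := sin_pos_of_pos_of_lt_pi ht.1 (by linarith [ht.2, pi_pos])
    have htan : tan t ≠ 0 := by rw [tan_eq_sin_div_cos]; positivity
    have h1 := hasDerivAt_tan hc.ne'
    have h2 := (continuous_dslope_arctan.integral_hasStrictDerivAt 0 (tan t)).hasDerivAt.comp t h1
    convert! ((hasDerivAt_id t).mul (h1.log htan)).sub h2 using 1
    have h3 := mul_dslope_arctan (tan t)
    rw [arctan_tan (by linarith [ht.1, pi_pos]) (by linarith [ht.2, pi_pos])] at h3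
    rw [← log_div hs.ne' hc.ne', ← tan_eq_sin_div_cos, id]
    nth_rw 3 [← h3]
    field_simp
    ring
  have hcont : ContinuousOn
      (fun t => t * log (tan t) - ∫ s in (0 : ℝ)..(tan t), dslope arctan 0 s)
      (Icc 0 (π / 4)) := by
    have htan : ContinuousOn tan (Icc 0 (π / 4)) :=
      continuousOn_tan.mono fun t ht => (cos_pos_of_mem_Icc ht).ne'
    have hF : Continuous fun x =>
        dslope arctan 0 x * (x * log x) - ∫ s in (0 : ℝ)..x, dslope arctan 0 s :=
      (continuous_dslope_arctan.mul continuous_mul_log).sub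
        (intervalIntegral.continuous_primitive
          (fun a b => continuous_dslope_arctan.intervalIntegrable a b) 0)
    refine (hF.comp_continuousOn htan).congr fun t ht => ?_
    have h3 := mul_dslope_arctan (tan t)
    rw [arctan_tan (by linarith [ht.1, pi_pos]) (by linarith [ht.2, pi_pos])] at h3
    simp only [Function.comp_apply]
    nth_rw 1 [← h3]
    ring
  rw [intervalIntegral.integral_eq_sub_of_hasDerivAt_of_le (by positivity) hcont hderiv
    (intervalIntegrable_log_sin.sub intervalIntegrable_log_cos)]
  simp [integral_dslope_arctan]

theorem integral_log_sin_add_log_cos :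
    ∫ t in (0 : ℝ)..(π / 4), (log (sin t) + log (cos t)) = -log 2 * π / 2 := by
  have h : ∫ t in (0 : ℝ)..(π / 4), log (cos t) = ∫ t in (π / 4)..(π / 2), log (sin t) := by
    simp_rw [← sin_pi_div_two_sub]
    rw [intervalIntegral.integral_comp_sub_left (fun t => log (sin t))]
    ring_nf
  have hs (a b : ℝ) : IntervalIntegrable (fun t => log (sin t)) volume a b :=
    intervalIntegrable_log_sin
  have hc : IntervalIntegrable (fun t => log (cos t)) volume 0 (π / 4) :=
    intervalIntegrable_log_cos
  rw [intervalIntegral.integral_add (hs _ _) hc, h,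
    intervalIntegral.integral_add_adjacent_intervals (hs _ _) (hs _ _),
    integral_log_sin_zero_pi_div_two]

theorem integral_log_one_add_sq_div_eq_integral_log_cos :
    ∫ x in (0 : ℝ)..1, log (1 + x ^ 2) / (1 + x ^ 2) =
      -2 * ∫ t in (0 : ℝ)..(π / 4), log (cos t) := by
  have hcos (x : ℝ) : log (cos (arctan x)) = -(log (1 + x ^ 2) / 2) := by
    rw [cos_arctan, one_div, log_inv, log_sqrt (by positivity)]
  have h := intervalIntegral.integral_comp_mul_deriv' (a := 0) (b := 1) (f := arctan)
    (f' := fun x => 1 / (1 + x ^ 2)) (g := fun t => log (cos t))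
    (fun x _ => hasDerivAt_arctan x)
    (Continuous.continuousOn (by fun_prop (disch := intro x; positivity)))
    (by
      refine continuous_cos.continuousOn.log ?_
      rintro _ ⟨x, -, rfl⟩
      exact (cos_arctan_pos x).ne')
  rw [arctan_zero, arctan_one] at h
  rw [← h, ← intervalIntegral.integral_const_mul]
  refine intervalIntegral.integral_congr fun x _ => ?_
  simp only [Function.comp_apply, hcos]
  ring

theorem stmt_6 :
    ∫ x in (0 : ℝ)..1, Real.log (1 + x ^ 2) / (1 + x ^ 2) = π / 2 * Real.log 2 - catalanG := by
  have hs : IntervalIntegrable (fun t => log (sin t)) volume 0 (π / 4) :=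
    intervalIntegrable_log_sin
  have hc : IntervalIntegrable (fun t => log (cos t)) volume 0 (π / 4) :=
    intervalIntegrable_log_cos
  have h1 := integral_log_sin_sub_log_cos
  have h2 := integral_log_sin_add_log_cos
  rw [intervalIntegral.integral_sub hs hc] at h1
  rw [intervalIntegral.integral_add hs hc] at h2
  rw [integral_log_one_add_sq_div_eq_integral_log_cos]
  linarith
end

section
/- ∫_0^1 ln(1+x²)/(1+x) dx = (3/4)(ln 2)² − π²/48. -/
open Real

lemma hasSum_neg_one_pow_div_sq :
    HasSum (fun n : ℕ => (-1 : ℝ) ^ n / ((n : ℝ) + 1) ^ 2) (π ^ 2 / 12) := by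
  have h := hasSum_zeta_two
  have he : HasSum (fun k : ℕ => (1 : ℝ) / ((2 * k : ℕ) : ℝ) ^ 2) (π ^ 2 / 24) := by
    have h4 := h.mul_left (1 / 4)
    rw [show 1 / 4 * (π ^ 2 / 6) = π ^ 2 / 24 by ring] at h4
    refine h4.congr_fun fun k => ?_
    push_cast
    ring
  have ho : HasSum (fun k : ℕ => (1 : ℝ) / ((2 * k + 1 : ℕ) : ℝ) ^ 2) (π ^ 2 / 8) := by
    have hs : Summable (fun k : ℕ => (1 : ℝ) / ((2 * k + 1 : ℕ) : ℝ) ^ 2) :=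
      h.summable.comp_injective (i := fun k : ℕ => 2 * k + 1) fun a b hab => by
        simp only at hab
        omega
    have huniq := (HasSum.even_add_odd (f := fun n : ℕ => (1 : ℝ) / (n : ℝ) ^ 2)
      he hs.hasSum).unique h
    rw [show π ^ 2 / 8 = ∑' k : ℕ, (1 : ℝ) / ((2 * k + 1 : ℕ) : ℝ) ^ 2 by linarith]
    exact hs.hasSum
  have hall : HasSum (fun n : ℕ => -(-1 : ℝ) ^ n / (n : ℝ) ^ 2) (-(π ^ 2 / 24) + π ^ 2 / 8) := by
    refine HasSum.even_add_odd ?_ ?_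
    · refine he.neg.congr_fun fun k => ?_
      simp [neg_div]
    · refine ho.congr_fun fun k => ?_
      simp [pow_succ]
  have hshift := (hasSum_nat_add_iff' 1).mpr hall
  rw [show -(π ^ 2 / 24) + π ^ 2 / 8 - ∑ i ∈ Finset.range 1, -(-1 : ℝ) ^ i / (i : ℝ) ^ 2
    = π ^ 2 / 12 by simp; ring] at hshift
  refine hshift.congr_fun fun n => ?_
  simp [pow_succ]

lemma hasSum_log_one_add_sq_div {a : ℝ} (h0 : 0 < a) (h1 : a < 1) :
    HasSum (fun n : ℕ => (-1) ^ n / ((n : ℝ) + 1) * a ^ (2 * n + 1)) (log (1 + a ^ 2) / a) := by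
  have h : |-a ^ 2| < 1 := by
    rw [abs_neg, abs_of_nonneg (sq_nonneg a)]
    nlinarith
  have hs := (hasSum_pow_div_log_of_abs_lt_one h).mul_left (-1 / a)
  rw [show -1 / a * -log (1 - -a ^ 2) = log (1 + a ^ 2) / a by rw [sub_neg_eq_add]; ring] at hs
  refine hs.congr_fun fun n => ?_
  rw [neg_pow (a ^ 2), ← pow_mul]
  field_simp
  ring

lemma integral_log_one_add_sq_div :
    ∫ a in (0 : ℝ)..1, log (1 + a ^ 2) / a = π ^ 2 / 24 := by
  let F : ℕ → ℝ → ℝ := fun n a => (-1) ^ n / ((n : ℝ) + 1) * a ^ (2 * n + 1)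
  have hint (n : ℕ) : ∫ a in (0 : ℝ)..1, F n a = 1 / 2 * ((-1) ^ n / ((n : ℝ) + 1) ^ 2) := by
    simp only [F, intervalIntegral.integral_const_mul, integral_pow]
    push_cast
    have : (n : ℝ) + 1 ≠ 0 := by positivity
    field_simp
    simp
    ring
  have hnorm (n : ℕ) : ∫ a in Set.Ioc (0 : ℝ) 1, ‖F n a‖ =
      ‖1 / 2 * ((-1 : ℝ) ^ n / ((n : ℝ) + 1) ^ 2)‖ := by
    have hcongr : ∀ a ∈ Set.Ioc (0 : ℝ) 1, ‖F n a‖ = (-1) ^ n * F n a := fun a ha => by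
      have hpos : 0 ≤ (-1) ^ n * F n a := by
        have : (-1) ^ n * F n a = 1 / ((n : ℝ) + 1) * a ^ (2 * n + 1) := by
          simp only [F, ← mul_assoc, ← mul_div_assoc, ← mul_pow]
          norm_num
        rw [this]
        have := ha.1
        positivity
      rw [← norm_of_nonneg hpos]
      simp
    rw [MeasureTheory.setIntegral_congr_fun measurableSet_Ioc hcongr,
      MeasureTheory.integral_const_mul, ← intervalIntegral.integral_of_le zero_le_one, hint,
      mul_left_comm, ← mul_div_assoc, ← mul_pow]
    simp
  have hsum := hasSum_neg_one_pow_div_sq.mul_left (1 / 2)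
  have hF := MeasureTheory.hasSum_integral_of_summable_integral_norm
    (μ := MeasureTheory.volume.restrict (Set.Ioc (0 : ℝ) 1)) (F := F)
    (fun n => (Continuous.integrableOn_Ioc (by fun_prop)))
    (by simpa only [hnorm] using hsum.summable.norm)
  simp only [← intervalIntegral.integral_of_le (zero_le_one' ℝ), hint] at hF
  have heq : ∫ a in (0 : ℝ)..1, log (1 + a ^ 2) / a = ∫ a in (0 : ℝ)..1, ∑' n, F n a := by
    refine intervalIntegral.integral_congr_ae ?_
    filter_upwards [MeasureTheory.Measure.ae_ne MeasureTheory.volume (1 : ℝ)] with a ha hmem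
    rw [Set.uIoc_of_le zero_le_one] at hmem
    exact (hasSum_log_one_add_sq_div hmem.1 (lt_of_le_of_ne hmem.2 ha)).tsum_eq.symm
  rw [heq, hF.unique hsum]
  ring

lemma integral_log_arctan_terms :
    ∫ a in (0 : ℝ)..1, (2 * a * log 2 / (1 + a ^ 2) - a * log (1 + a ^ 2) / (1 + a ^ 2)
      - 2 * arctan a / (1 + a ^ 2)) = 3 / 4 * log 2 ^ 2 - π ^ 2 / 16 := by
  have hp (a : ℝ) : 1 + a ^ 2 ≠ 0 := by positivity
  rw [intervalIntegral.integral_eq_sub_of_hasDerivAt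
    (f := fun a => log 2 * log (1 + a ^ 2) - log (1 + a ^ 2) ^ 2 / 4 - arctan a ^ 2)]
  · norm_num
    ring
  · intro a _
    have hl : HasDerivAt (fun a : ℝ => log (1 + a ^ 2)) (2 * a / (1 + a ^ 2)) a := by
      simpa using ((hasDerivAt_pow 2 a).const_add 1).log (hp a)
    refine (((hl.const_mul (log 2)).sub ((hl.pow 2).div_const 4)).sub
      ((hasDerivAt_arctan a).pow 2)).congr_deriv ?_
    have := hp a
    push_cast
    field_simp
    ring
  · apply Continuous.intervalIntegrable
    fun_prop (disch := first | exact hp | (intro; positivity))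

lemma integral_kernel_snd {a : ℝ} (ha : a ≠ 0) :
    ∫ x in (0 : ℝ)..1, 2 * a * x ^ 2 / ((1 + a ^ 2 * x ^ 2) * (1 + x)) =
      (2 * a * log 2 / (1 + a ^ 2) - a * log (1 + a ^ 2) / (1 + a ^ 2)
        - 2 * arctan a / (1 + a ^ 2)) + log (1 + a ^ 2) / a := by
  have hp (x : ℝ) : 1 + a ^ 2 * x ^ 2 ≠ 0 := by positivity
  rw [intervalIntegral.integral_eq_sub_of_hasDerivAt
    (f := fun x => 2 * a / (1 + a ^ 2) *
      (log (1 + x) + log (1 + a ^ 2 * x ^ 2) / (2 * a ^ 2) - arctan (a * x) / a))]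
  · norm_num
    have : 1 + a ^ 2 ≠ 0 := by positivity
    field_simp
    ring
  · intro x hx
    rw [Set.uIcc_of_le zero_le_one] at hx
    have hx0 : 1 + x ≠ 0 := by linarith [hx.1]
    have h1 : HasDerivAt (fun x : ℝ => log (1 + x)) (1 / (1 + x)) x :=
      ((hasDerivAt_id x).const_add 1).log hx0
    have h2 : HasDerivAt (fun x : ℝ => log (1 + a ^ 2 * x ^ 2))
        (a ^ 2 * (2 * x) / (1 + a ^ 2 * x ^ 2)) x := by
      simpa using (((hasDerivAt_pow 2 x).const_mul (a ^ 2)).const_add 1).log (hp x)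
    have h3 := ((hasDerivAt_id x).const_mul a).arctan
    refine (((h1.add (h2.div_const (2 * a ^ 2))).sub (h3.div_const a)).const_mul
      (2 * a / (1 + a ^ 2))).congr_deriv ?_
    have : 1 + a ^ 2 ≠ 0 := by positivity
    have := hp x
    simp only [id, mul_pow]
    field_simp
    ring
  · apply ContinuousOn.intervalIntegrable
    rw [Set.uIcc_of_le zero_le_one]
    refine ContinuousOn.div (by fun_prop) (by fun_prop) fun x hx => ?_
    have := hx.1
    positivity

lemma integral_kernel_fst (x : ℝ) :
    ∫ a in (0 : ℝ)..1, 2 * a * x ^ 2 / ((1 + a ^ 2 * x ^ 2) * (1 + x)) =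
      log (1 + x ^ 2) / (1 + x) := by
  have hp (a : ℝ) : 1 + a ^ 2 * x ^ 2 ≠ 0 := by positivity
  rw [intervalIntegral.integral_eq_sub_of_hasDerivAt
    (f := fun a => log (1 + a ^ 2 * x ^ 2) / (1 + x))]
  · simp
  · intro a _
    refine (((((hasDerivAt_pow 2 a).mul_const (x ^ 2)).const_add 1).log (hp a)).div_const
      (1 + x)).congr_deriv ?_
    rw [div_div]
    norm_num
  · apply Continuous.intervalIntegrable
    simp only [← div_div]
    exact (Continuous.div (by fun_prop) (by fun_prop) hp).div_const _

theorem stmt_7 :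
    ∫ x in (0 : ℝ)..1, Real.log (1 + x ^ 2) / (1 + x) =
      3 / 4 * (Real.log 2) ^ 2 - π ^ 2 / 48 := by
  simp_rw [← integral_kernel_fst]
  rw [MeasureTheory.intervalIntegral_intervalIntegral_swap]
  · have hlog : IntervalIntegrable (fun a : ℝ => log (1 + a ^ 2) / a) MeasureTheory.volume 0 1 := by
      apply intervalIntegral.intervalIntegrable_of_integral_ne_zero
      rw [integral_log_one_add_sq_div]
      positivity
    have hp (a : ℝ) : 1 + a ^ 2 ≠ 0 := by positivity
    rw [intervalIntegral.integral_congr_uIoo (g := fun a => (2 * a * log 2 / (1 + a ^ 2)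
        - a * log (1 + a ^ 2) / (1 + a ^ 2) - 2 * arctan a / (1 + a ^ 2)) + log (1 + a ^ 2) / a),
      intervalIntegral.integral_add _ hlog, integral_log_arctan_terms, integral_log_one_add_sq_div]
    · ring
    · apply Continuous.intervalIntegrable
      fun_prop (disch := first | exact hp | (intro; positivity))
    · intro a ha
      rw [Set.uIoo_of_le zero_le_one] at ha
      exact integral_kernel_snd ha.1.ne'
  · have hcont : ContinuousOn (Function.uncurry fun x a : ℝ =>
        2 * a * x ^ 2 / ((1 + a ^ 2 * x ^ 2) * (1 + x))) (Set.Icc 0 1 ×ˢ Set.Icc 0 1) := by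
      refine ContinuousOn.div (by fun_prop) (by fun_prop) fun p hp => ?_
      have := hp.1.1
      positivity
    rw [Set.uIoc_of_le zero_le_one]
    exact (hcont.integrableOn_compact (isCompact_Icc.prod isCompact_Icc)).mono_set
      (Set.prod_mono Set.Ioc_subset_Icc_self Set.Ioc_subset_Icc_self)
end

section
/- ∫_0^1 (arctan x)/(1+x) dx = (π/8) ln 2. -/
open Real

theorem one_add_one_sub_div_one_add {x : ℝ} (hx : 1 + x ≠ 0) :
    1 + (1 - x) / (1 + x) = 2 / (1 + x) := by
  field_simp
  ring

theorem arctan_one_sub_div_one_add {x : ℝ} (hx : 0 < 1 + x) :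
    arctan ((1 - x) / (1 + x)) = π / 4 - arctan x := by
  have hprod : x * ((1 - x) / (1 + x)) < 1 := by
    rw [← mul_div_assoc, div_lt_one hx]
    nlinarith [sq_nonneg x]
  have hquot : (x + (1 - x) / (1 + x)) / (1 - x * ((1 - x) / (1 + x))) = 1 := by
    rw [div_eq_one_iff_eq (sub_pos.2 hprod).ne']
    field_simp
    ring
  have h := arctan_add hprod
  rw [hquot, arctan_one] at h
  linarith

theorem hasDerivAt_one_sub_div_one_add {x : ℝ} (hx : 1 + x ≠ 0) :
    HasDerivAt (fun y : ℝ => (1 - y) / (1 + y)) (-2 / (1 + x) ^ 2) x := by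
  refine (((hasDerivAt_id' x).const_sub 1).div ((hasDerivAt_id' x).const_add 1) hx).congr_deriv ?_
  ring

theorem stmt_8 :
    ∫ x in (0 : ℝ)..1, Real.arctan x / (1 + x) = π / 8 * Real.log 2 := by
  have hpos : ∀ x ∈ Set.uIcc (0 : ℝ) 1, 0 < 1 + x := by
    intro x hx
    rw [Set.uIcc_of_le zero_le_one] at hx
    linarith [hx.1]
  have hcont : ContinuousOn (fun x : ℝ => arctan x / (1 + x)) (Set.uIcc 0 1) :=
    continuous_arctan.continuousOn.div (by fun_prop) fun x hx => (hpos x hx).ne'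
  have hcont_inv : ContinuousOn (fun x : ℝ => π / 4 * (1 + x)⁻¹) (Set.uIcc 0 1) :=
    continuousOn_const.mul (ContinuousOn.inv₀ (by fun_prop) fun x hx => (hpos x hx).ne')
  have hlog : ∫ x in (0 : ℝ)..1, (1 + x)⁻¹ = log 2 := by
    rw [intervalIntegral.integral_comp_add_left (fun x : ℝ => x⁻¹) 1,
      integral_inv_of_pos (by norm_num) (by norm_num)]
    norm_num
  have hsubst := intervalIntegral.integral_comp_mul_deriv' (a := 0) (b := 1)
    (f := fun x : ℝ => (1 - x) / (1 + x)) (f' := fun x => -2 / (1 + x) ^ 2)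
    (g := fun x : ℝ => arctan x / (1 + x))
    (fun x hx => hasDerivAt_one_sub_div_one_add (hpos x hx).ne')
    (continuousOn_const.div (by fun_prop) fun x hx => pow_ne_zero 2 (hpos x hx).ne')
    (continuous_arctan.continuousOn.div (by fun_prop) (by
      rintro _ ⟨x, hx, rfl⟩
      have h := hpos x hx
      rw [one_add_one_sub_div_one_add h.ne']
      positivity))
  have hintegrand : ∀ x ∈ Set.uIcc (0 : ℝ) 1,
      ((fun x : ℝ => arctan x / (1 + x)) ∘ fun x : ℝ => (1 - x) / (1 + x)) x
        * (-2 / (1 + x) ^ 2) = arctan x / (1 + x) - π / 4 * (1 + x)⁻¹ := by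
    intro x hx
    have h := hpos x hx
    simp only [Function.comp_apply]
    rw [arctan_one_sub_div_one_add h, one_add_one_sub_div_one_add h.ne']
    field_simp
    ring
  rw [intervalIntegral.integral_congr hintegrand,
    intervalIntegral.integral_sub hcont.intervalIntegrable hcont_inv.intervalIntegrable,
    intervalIntegral.integral_const_mul, hlog] at hsubst
  norm_num at hsubst
  rw [intervalIntegral.integral_symm 0 1] at hsubst
  linarith
end

section
/- ∫_0^1 ln(1+x²) / ((1+x²)(1+x)) dx = (1/2)( (1/2)(ln 2)² − π²/48 + (π/2) ln 2 − G ), where G is Catalan's constant. -/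
open Real

open MeasureTheory Set

lemma integral_eq_integral_abs_deriv_mul_comp {φ φ' : ℝ → ℝ} {a b c d : ℝ} (hab : a ≤ b)
    (hcd : c ≤ d) (himg : φ '' Ioo a b = Ioo c d)
    (hφ : ∀ x ∈ Ioo a b, HasDerivAt φ (φ' x) x) (hinj : InjOn φ (Ioo a b)) (f : ℝ → ℝ) :
    ∫ y in c..d, f y = ∫ x in a..b, |φ' x| * f (φ x) := by
  rw [intervalIntegral.integral_of_le hab, intervalIntegral.integral_of_le hcd,
    integral_Ioc_eq_integral_Ioo, integral_Ioc_eq_integral_Ioo, ← himg,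
    integral_image_eq_integral_abs_deriv_smul measurableSet_Ioo
      (fun x hx => (hφ x hx).hasDerivWithinAt) hinj]
  rfl

lemma integral_comp_mobius (f : ℝ → ℝ) :
    ∫ x in (0 : ℝ)..1, f x = ∫ t in (0 : ℝ)..1, 2 / (1 + t) ^ 2 * f ((1 - t) / (1 + t)) := by
  rw [integral_eq_integral_abs_deriv_mul_comp (φ := fun t => (1 - t) / (1 + t))
    (φ' := fun t => -(2 / (1 + t) ^ 2)) zero_le_one zero_le_one]
  · refine intervalIntegral.integral_congr_Ioo_of_le zero_le_one fun t _ => ?_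
    rw [abs_neg, abs_of_nonneg (by positivity)]
  · ext y
    constructor
    · rintro ⟨t, ⟨h0, h1⟩, rfl⟩
      have : 0 < 1 + t := by linarith
      exact ⟨by simp only; apply div_pos <;> linarith, by simp only; rw [div_lt_one this]; linarith⟩
    · rintro ⟨h0, h1⟩
      have : 0 < 1 + y := by linarith
      refine ⟨(1 - y) / (1 + y), ⟨by apply div_pos <;> linarith,
        by rw [div_lt_one this]; linarith⟩, ?_⟩
      field_simp
      ring
  · intro t ht
    have : 1 + t ≠ 0 := by linarith [ht.1]
    refine (((hasDerivAt_id' t).const_sub 1).div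
      ((hasDerivAt_id' t).const_add 1) this).congr_deriv ?_
    field_simp
    ring
  · intro s hs t ht h
    have h1 : 1 + s ≠ 0 := by linarith [hs.1]
    have h2 : 1 + t ≠ 0 := by linarith [ht.1]
    simp only at h
    rw [div_eq_div_iff h1 h2] at h
    linarith

lemma integral_comp_sq (f : ℝ → ℝ) :
    ∫ x in (0 : ℝ)..1, f x = ∫ t in (0 : ℝ)..1, 2 * t * f (t ^ 2) := by
  rw [integral_eq_integral_abs_deriv_mul_comp (φ := fun t => t ^ 2)
    (φ' := fun t => 2 * t) zero_le_one zero_le_one]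
  · refine intervalIntegral.integral_congr_Ioo_of_le zero_le_one fun t ht => ?_
    rw [abs_of_nonneg (by linarith [ht.1])]
  · ext y
    constructor
    · rintro ⟨t, ⟨h0, h1⟩, rfl⟩
      exact ⟨by positivity, by simp only; nlinarith⟩
    · rintro ⟨h0, h1⟩
      exact ⟨√y, ⟨by positivity, by rw [Real.sqrt_lt' one_pos]; linarith⟩, Real.sq_sqrt h0.le⟩
  · intro t _
    simpa using hasDerivAt_pow 2 t
  · intro s hs t ht h
    exact (pow_left_inj₀ hs.1.le ht.1.le two_ne_zero).1 h

lemma integral_comp_arctan (f : ℝ → ℝ) :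
    ∫ θ in (0 : ℝ)..π / 4, f θ = ∫ x in (0 : ℝ)..1, f (arctan x) / (1 + x ^ 2) := by
  rw [integral_eq_integral_abs_deriv_mul_comp (φ := arctan)
    (φ' := fun x => 1 / (1 + x ^ 2)) zero_le_one (by positivity)]
  · refine intervalIntegral.integral_congr_Ioo_of_le zero_le_one fun t _ => ?_
    rw [abs_of_nonneg (by positivity)]
    ring
  · ext y
    constructor
    · rintro ⟨t, ⟨h0, h1⟩, rfl⟩
      exact ⟨by simpa using arctan_strictMono h0, by simpa using arctan_strictMono h1⟩
    · rintro ⟨h0, h1⟩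
      have hpi := Real.pi_pos
      have hy : arctan (tan y) = y := arctan_tan (by linarith) (by linarith)
      refine ⟨tan y, ⟨?_, ?_⟩, hy⟩
      · rw [← arctan_strictMono.lt_iff_lt, hy]; simpa
      · rw [← arctan_strictMono.lt_iff_lt, hy]; simpa
  · intro x _
    exact hasDerivAt_arctan x
  · exact arctan_injective.injOn

lemma intervalIntegrable_pow_mul_log (n : ℕ) :
    IntervalIntegrable (fun x => x ^ n * log x) volume 0 1 :=
  intervalIntegral.intervalIntegrable_log'.continuousOn_mul (by fun_prop)

lemma integral_pow_mul_log (n : ℕ) :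
    ∫ x in (0 : ℝ)..1, x ^ n * log x = -(1 / ((n : ℝ) + 1) ^ 2) := by
  have hn : (n : ℝ) + 1 ≠ 0 := by positivity
  rw [intervalIntegral.integral_eq_sub_of_hasDerivAt_of_le
    (f := fun x => x ^ n * (x * log x) / (n + 1) - x ^ (n + 1) / ((n : ℝ) + 1) ^ 2) zero_le_one]
  · simp
  · have := Real.continuous_mul_log
    fun_prop
  · intro x hx
    have hx0 : x ≠ 0 := hx.1.ne'
    have h : HasDerivAt (fun x => x ^ (n + 1) * log x / (n + 1) - x ^ (n + 1) / ((n : ℝ) + 1) ^ 2)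
        (x ^ n * log x) x := by
      refine ((((hasDerivAt_pow (n + 1) x).mul (hasDerivAt_log hx0)).div_const
        ((n : ℝ) + 1)).sub ((hasDerivAt_pow (n + 1) x).div_const
          (((n : ℝ) + 1) ^ 2))).congr_deriv ?_
      simp only [Nat.add_sub_cancel]
      push_cast
      field_simp
      ring
    exact h.congr_of_eventuallyEq (.of_forall fun y => by ring)
  · exact intervalIntegrable_pow_mul_log n

lemma hasSum_integral_log_div_one_add_pow {m : ℕ} (hm : m ≠ 0) :
    HasSum (fun k : ℕ => (-1 : ℝ) ^ k / ((m : ℝ) * k + 1) ^ 2)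
      (-∫ x in (0 : ℝ)..1, log x / (1 + x ^ m)) := by
  have hint (f : ℝ → ℝ) : ∫ x in (0 : ℝ)..1, f x = ∫ x in Ioo (0 : ℝ) 1, f x := by
    rw [intervalIntegral.integral_of_le zero_le_one, integral_Ioc_eq_integral_Ioo]
  have hnorm (k : ℕ) : ∫ x in Ioo (0 : ℝ) 1, ‖-((-1) ^ k * (x ^ (m * k) * log x))‖ =
      1 / ((m : ℝ) * k + 1) ^ 2 := by
    have h := integral_pow_mul_log (m * k)
    rw [hint] at h
    push_cast at h
    rw [← neg_eq_iff_eq_neg.2 h, ← integral_neg]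
    refine setIntegral_congr_fun measurableSet_Ioo fun x hx => ?_
    have h1 : x ^ (m * k) * log x ≤ 0 :=
      mul_nonpos_of_nonneg_of_nonpos (pow_nonneg hx.1.le _) (log_nonpos hx.1.le hx.2.le)
    rw [norm_neg, norm_mul, norm_pow, norm_neg, norm_one, one_pow, one_mul, Real.norm_of_nonpos h1]
  have hs := hasSum_integral_of_summable_integral_norm (μ := volume.restrict (Ioo (0 : ℝ) 1))
    (F := fun (k : ℕ) x => -((-1) ^ k * (x ^ (m * k) * log x))) ?_ ?_
  · have hterm (k : ℕ) : ∫ x in Ioo (0 : ℝ) 1, -((-1) ^ k * (x ^ (m * k) * log x)) =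
        (-1) ^ k / ((m : ℝ) * k + 1) ^ 2 := by
      have h := integral_pow_mul_log (m * k)
      rw [hint] at h
      rw [integral_neg, integral_const_mul, h]
      push_cast
      ring
    have hlim : ∫ x in Ioo (0 : ℝ) 1, ∑' k : ℕ, -((-1) ^ k * (x ^ (m * k) * log x)) =
        -∫ x in (0 : ℝ)..1, log x / (1 + x ^ m) := by
      rw [hint, ← integral_neg]
      refine setIntegral_congr_fun measurableSet_Ioo fun x hx => ?_
      have hx1 : ‖-x ^ m‖ < 1 := by
        rw [norm_neg, norm_pow, Real.norm_of_nonneg hx.1.le]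
        exact pow_lt_one₀ hx.1.le hx.2 hm
      have h := (hasSum_geometric_of_norm_lt_one hx1).mul_right (-log x)
      have hgeom : (fun k : ℕ => -((-1) ^ k * (x ^ (m * k) * log x))) =
          fun k => (-x ^ m) ^ k * -log x := by
        ext k
        rw [neg_pow (x ^ m), pow_mul]
        ring
      rw [hgeom, h.tsum_eq, sub_neg_eq_add]
      ring
    simpa only [hterm, hlim] using hs
  · intro k
    have h := intervalIntegrable_pow_mul_log (m * k)
    rw [intervalIntegrable_iff_integrableOn_Ioo_of_le zero_le_one] at h
    exact (h.const_mul _).neg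
  · simp only [hnorm]
    have h : Summable fun k : ℕ => 1 / ((k : ℝ) + 1) ^ 2 := by
      exact_mod_cast (summable_nat_add_iff 1).2 (hasSum_zeta_two.summable)
    refine h.of_nonneg_of_le (fun k => by positivity) fun k => ?_
    have : (1 : ℝ) ≤ m := by exact_mod_cast Nat.one_le_iff_ne_zero.2 hm
    have hk : (0 : ℝ) ≤ k := k.cast_nonneg
    gcongr
    nlinarith

lemma integral_log_div_one_add_sq : ∫ x in (0 : ℝ)..1, log x / (1 + x ^ 2) = -catalanG := by
  have h := (hasSum_integral_log_div_one_add_pow two_ne_zero).tsum_eq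
  rw [catalanG]
  push_cast at h
  linarith

lemma integral_log_div_one_add : ∫ x in (0 : ℝ)..1, log x / (1 + x) = -(π ^ 2 / 12) := by
  have h := hasSum_integral_log_div_one_add_pow one_ne_zero
  simp only [Nat.cast_one, one_mul, pow_one] at h
  have hz : HasSum (fun n : ℕ => 1 / ((n : ℝ) + 1) ^ 2) (π ^ 2 / 6) := by
    have := (hasSum_nat_add_iff' 1).2 hasSum_zeta_two
    simpa using this
  have hd : HasSum (fun n : ℕ => 1 / ((n : ℝ) + 1) ^ 2 - (-1 : ℝ) ^ n / ((n : ℝ) + 1) ^ 2)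
      (0 + π ^ 2 / 12) := by
    refine HasSum.even_add_odd ?_ ?_
    · simp
    · have hodd (k : ℕ) : 1 / (((2 * k + 1 : ℕ) : ℝ) + 1) ^ 2 -
          (-1 : ℝ) ^ (2 * k + 1) / (((2 * k + 1 : ℕ) : ℝ) + 1) ^ 2 =
          1 / ((k : ℝ) + 1) ^ 2 / 2 := by
        rw [(show Odd (2 * k + 1) from ⟨k, rfl⟩).neg_one_pow]
        push_cast
        rw [show (2 * (k : ℝ) + 1 + 1) = 2 * (k + 1) by ring]
        field_simp
        norm_num
      simp only [hodd]
      rw [show π ^ 2 / 12 = π ^ 2 / 6 / 2 by ring]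
      exact hz.div_const 2
  have := hd.unique (hz.sub h)
  linarith

lemma integral_mul_log_div_one_add_sq :
    ∫ x in (0 : ℝ)..1, x * log x / (1 + x ^ 2) = -(π ^ 2 / 48) := by
  have h := integral_comp_sq fun x => log x / (1 + x)
  rw [integral_log_div_one_add] at h
  have h2 : ∫ x in (0 : ℝ)..1, 2 * x * (log (x ^ 2) / (1 + x ^ 2)) =
      4 * ∫ x in (0 : ℝ)..1, x * log x / (1 + x ^ 2) := by
    rw [← intervalIntegral.integral_const_mul]
    congr 1
    ext x
    rw [log_pow]
    push_cast
    ring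
  linarith

lemma integral_log_one_add_div_one_add :
    ∫ x in (0 : ℝ)..1, log (1 + x) / (1 + x) = log 2 ^ 2 / 2 := by
  rw [intervalIntegral.integral_eq_sub_of_hasDerivAt (f := fun x => log (1 + x) ^ 2 / 2)]
  · norm_num
  · intro x hx
    rw [uIcc_of_le zero_le_one] at hx
    have h0 : 1 + x ≠ 0 := by linarith [hx.1]
    refine (((((hasDerivAt_id' x).const_add 1).log h0).pow 2).div_const 2).congr_deriv ?_
    push_cast
    field_simp
  · refine ContinuousOn.intervalIntegrable fun x hx => ?_
    rw [uIcc_of_le zero_le_one] at hx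
    have h0 : 1 + x ≠ 0 := by linarith [hx.1]
    exact ContinuousAt.continuousWithinAt (by fun_prop (disch := assumption))

lemma integral_mul_log_one_add_sq_div_one_add_sq :
    ∫ x in (0 : ℝ)..1, x * log (1 + x ^ 2) / (1 + x ^ 2) = log 2 ^ 2 / 4 := by
  have h := integral_comp_sq fun x => log (1 + x) / (1 + x)
  rw [integral_log_one_add_div_one_add] at h
  have h2 : ∫ x in (0 : ℝ)..1, 2 * x * (log (1 + x ^ 2) / (1 + x ^ 2)) =
      2 * ∫ x in (0 : ℝ)..1, x * log (1 + x ^ 2) / (1 + x ^ 2) := by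
    rw [← intervalIntegral.integral_const_mul]
    congr 1
    ext x
    ring
  linarith

lemma continuousOn_inv_one_add : ContinuousOn (fun x : ℝ => (1 + x)⁻¹) (uIcc 0 1) := by
  intro x hx
  rw [uIcc_of_le zero_le_one] at hx
  have h0 : 1 + x ≠ 0 := by linarith [hx.1]
  exact ContinuousAt.continuousWithinAt (by fun_prop (disch := assumption))

lemma continuousOn_log_one_add : ContinuousOn (fun x : ℝ => log (1 + x)) (uIcc 0 1) := by
  intro x hx
  rw [uIcc_of_le zero_le_one] at hx
  have h0 : 1 + x ≠ 0 := by linarith [hx.1]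
  exact ContinuousAt.continuousWithinAt (by fun_prop (disch := assumption))

lemma continuous_inv_one_add_sq : Continuous fun x : ℝ => (1 + x ^ 2)⁻¹ :=
  Continuous.inv₀ (by fun_prop) fun x => by positivity

lemma continuous_log_one_add_sq : Continuous fun x : ℝ => log (1 + x ^ 2) :=
  Continuous.log (by fun_prop) fun x => by positivity

lemma integral_log_one_sub_div_one_add :
    ∫ x in (0 : ℝ)..1, log (1 - x) / (1 + x) = log 2 ^ 2 / 2 - π ^ 2 / 12 := by
  rw [integral_comp_mobius]
  have hc := continuousOn_inv_one_add
  have i1 : IntervalIntegrable (fun x : ℝ => log 2 * (1 + x)⁻¹) volume 0 1 :=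
    (hc.const_mul _).intervalIntegrable
  have i2 : IntervalIntegrable (fun x : ℝ => log x / (1 + x)) volume 0 1 :=
    intervalIntegral.intervalIntegrable_log'.mul_continuousOn hc
  have i3 : IntervalIntegrable (fun x : ℝ => log (1 + x) / (1 + x)) volume 0 1 :=
    (continuousOn_log_one_add.mul hc).intervalIntegrable
  have hl : ∫ x in (0 : ℝ)..1, (1 + x)⁻¹ = log 2 := by
    rw [intervalIntegral.integral_comp_add_left (fun x => x⁻¹), integral_inv_of_pos] <;> norm_num
  have h := intervalIntegral.integral_sub (i1.add i2) i3
  rw [intervalIntegral.integral_add i1 i2, intervalIntegral.integral_const_mul, hl,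
    integral_log_div_one_add, integral_log_one_add_div_one_add] at h
  rw [show log 2 ^ 2 / 2 - π ^ 2 / 12 = log 2 * log 2 + -(π ^ 2 / 12) - log 2 ^ 2 / 2 by ring, ← h]
  refine intervalIntegral.integral_congr_Ioo_of_le zero_le_one fun t ht => ?_
  have h0 := ht.1
  have h1 : 1 + t ≠ 0 := by linarith
  rw [show 1 - (1 - t) / (1 + t) = 2 * t / (1 + t) by field_simp; ring,
    show 1 + (1 - t) / (1 + t) = 2 / (1 + t) by field_simp; ring,
    log_div (by positivity) h1, log_mul two_ne_zero h0.ne']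
  field_simp

lemma integral_mul_log_one_add_div_one_add_sq :
    ∫ x in (0 : ℝ)..1, x * log (1 + x) / (1 + x ^ 2) = log 2 ^ 2 / 8 + π ^ 2 / 96 := by
  have hc : ContinuousOn (fun x : ℝ => x * (1 + x ^ 2)⁻¹) (uIcc 0 1) :=
    (continuous_id.mul continuous_inv_one_add_sq).continuousOn
  have im : IntervalIntegrable (fun x : ℝ => log (1 - x) * (x * (1 + x ^ 2)⁻¹)) volume 0 1 := by
    have : IntervalIntegrable (fun x : ℝ => log (1 - x)) volume 0 1 := by
      simpa using (intervalIntegral.intervalIntegrable_log' (a := 1) (b := 0)).comp_sub_left 1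
    exact this.mul_continuousOn hc
  have ip : IntervalIntegrable (fun x : ℝ => log (1 + x) * (x * (1 + x ^ 2)⁻¹)) volume 0 1 :=
    (continuousOn_log_one_add.mul hc).intervalIntegrable
  have hsum : ∫ x in (0 : ℝ)..1, (log (1 - x) * (x * (1 + x ^ 2)⁻¹) +
      log (1 + x) * (x * (1 + x ^ 2)⁻¹)) = (log 2 ^ 2 / 2 - π ^ 2 / 12) / 2 := by
    rw [← integral_log_one_sub_div_one_add,
      integral_comp_sq fun x => log (1 - x) / (1 + x),
      ← intervalIntegral.integral_div]
    refine intervalIntegral.integral_congr_Ioo_of_le zero_le_one fun t ht => ?_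
    rw [show 1 - t ^ 2 = (1 - t) * (1 + t) by ring,
      log_mul (by linarith [ht.2]) (by linarith [ht.1])]
    ring
  have hdiff : ∫ x in (0 : ℝ)..1, (log (1 - x) * (x * (1 + x ^ 2)⁻¹) -
      log (1 + x) * (x * (1 + x ^ 2)⁻¹)) = -(π ^ 2 / 12) - -(π ^ 2 / 48) := by
    have i1 : IntervalIntegrable (fun x : ℝ => log x / (1 + x)) volume 0 1 :=
      intervalIntegral.intervalIntegrable_log'.mul_continuousOn continuousOn_inv_one_add
    have i2 : IntervalIntegrable (fun x : ℝ => x * log x / (1 + x ^ 2)) volume 0 1 :=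
      (intervalIntegral.intervalIntegrable_log'.continuousOn_mul continuousOn_id).mul_continuousOn
        continuous_inv_one_add_sq.continuousOn
    rw [← integral_log_div_one_add, ← integral_mul_log_div_one_add_sq,
      ← intervalIntegral.integral_sub i1 i2, integral_comp_mobius]
    refine intervalIntegral.integral_congr_Ioo_of_le zero_le_one fun t ht => ?_
    have h0 := ht.1
    have h1 : 1 + t ≠ 0 := by linarith
    have h2 : 1 + t ^ 2 ≠ 0 := by positivity
    rw [show 1 - (1 - t) / (1 + t) = 2 * t / (1 + t) by field_simp; ring,
      show 1 + (1 - t) / (1 + t) = 2 / (1 + t) by field_simp; ring,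
      show 1 + ((1 - t) / (1 + t)) ^ 2 = 2 * (1 + t ^ 2) / (1 + t) ^ 2 by field_simp; ring,
      log_div (by positivity) h1, log_mul two_ne_zero h0.ne', log_div two_ne_zero h1]
    field_simp
    ring
  rw [intervalIntegral.integral_add im ip] at hsum
  rw [intervalIntegral.integral_sub im ip] at hdiff
  rw [show (fun x : ℝ => x * log (1 + x) / (1 + x ^ 2)) =
    fun x => log (1 + x) * (x * (1 + x ^ 2)⁻¹) by ext; ring]
  linarith

lemma integral_log_one_add_sq_div_one_add :
    ∫ x in (0 : ℝ)..1, log (1 + x ^ 2) / (1 + x) = 3 / 4 * log 2 ^ 2 - π ^ 2 / 48 := by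
  have i1 : IntervalIntegrable (fun x : ℝ => log (1 + x ^ 2) / (1 + x)) volume 0 1 :=
    (continuous_log_one_add_sq.continuousOn.mul continuousOn_inv_one_add).intervalIntegrable
  have i2 : IntervalIntegrable (fun x : ℝ => 2 * (x * log (1 + x) / (1 + x ^ 2))) volume 0 1 :=
    (((continuousOn_id.mul continuousOn_log_one_add).mul
      continuous_inv_one_add_sq.continuousOn).const_mul 2).intervalIntegrable
  have h := intervalIntegral.integral_eq_sub_of_hasDerivAt
    (f := fun x => log (1 + x) * log (1 + x ^ 2)) (a := 0) (b := 1) (fun x hx => ?_) (i1.add i2)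
  · rw [intervalIntegral.integral_add i1 i2, intervalIntegral.integral_const_mul,
      integral_mul_log_one_add_div_one_add_sq] at h
    norm_num at h
    linarith
  · rw [uIcc_of_le zero_le_one] at hx
    have h0 : 1 + x ≠ 0 := by linarith [hx.1]
    have h1 : 1 + x ^ 2 ≠ 0 := by positivity
    refine ((((hasDerivAt_id' x).const_add 1).log h0).mul
      (((hasDerivAt_pow 2 x).const_add 1).log h1)).congr_deriv ?_
    push_cast
    field_simp

lemma integral_log_cos_zero_pi_div_four :
    ∫ θ in (0 : ℝ)..π / 4, log (cos θ) = catalanG / 2 - π / 4 * log 2 := by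
  have is (a b : ℝ) : IntervalIntegrable (fun x => log (sin x)) volume a b :=
    intervalIntegrable_log_sin
  have ic : IntervalIntegrable (fun x => log (cos x)) volume 0 (π / 4) :=
    intervalIntegrable_log_cos
  have h1 := intervalIntegral.integral_add_adjacent_intervals (is 0 (π / 4)) (is (π / 4) (π / 2))
  have h2 : ∫ x in (π / 4)..(π / 2), log (sin x) = ∫ x in (0 : ℝ)..(π / 4), log (cos x) := by
    have := intervalIntegral.integral_comp_sub_left (a := 0) (b := π / 4)
      (fun x => log (sin x)) (π / 2)
    simp only [sin_pi_div_two_sub] at this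
    rw [this, sub_zero, show π / 2 - π / 4 = π / 4 by ring]
  have h3 : ∫ x in (0 : ℝ)..(π / 4), (log (sin x) - log (cos x)) = -catalanG := by
    rw [← integral_log_div_one_add_sq, integral_comp_arctan]
    refine intervalIntegral.integral_congr_Ioo_of_le zero_le_one fun t ht => ?_
    have hs : 0 < sin (arctan t) := sin_arctan_pos.2 ht.1
    rw [← log_div hs.ne' (cos_arctan_pos t).ne', ← tan_eq_sin_div_cos, tan_arctan]
  rw [intervalIntegral.integral_sub (is _ _) ic] at h3
  rw [integral_log_sin_zero_pi_div_two] at h1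
  linarith

lemma integral_log_one_add_sq_div_one_add_sq :
    ∫ x in (0 : ℝ)..1, log (1 + x ^ 2) / (1 + x ^ 2) = π / 2 * log 2 - catalanG := by
  have h := integral_log_cos_zero_pi_div_four
  rw [integral_comp_arctan] at h
  rw [show π / 2 * log 2 - catalanG = -2 * (catalanG / 2 - π / 4 * log 2) by ring, ← h,
    ← intervalIntegral.integral_const_mul]
  congr 1
  ext x
  have h2 := congrArg log (cos_sq_arctan x)
  rw [log_pow, one_div, log_inv] at h2
  push_cast at h2
  rw [← neg_eq_iff_eq_neg.2 h2]
  ring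

theorem stmt_12 :
    ∫ x in (0 : ℝ)..1, Real.log (1 + x ^ 2) / ((1 + x ^ 2) * (1 + x)) =
      1 / 2 * (1 / 2 * (Real.log 2) ^ 2 - π ^ 2 / 48 + π / 2 * Real.log 2 - catalanG) := by
  have i1 : IntervalIntegrable (fun x : ℝ => log (1 + x ^ 2) / (1 + x)) volume 0 1 :=
    (continuous_log_one_add_sq.continuousOn.mul continuousOn_inv_one_add).intervalIntegrable
  have i2 : IntervalIntegrable (fun x : ℝ => log (1 + x ^ 2) / (1 + x ^ 2)) volume 0 1 :=
    (continuous_log_one_add_sq.mul continuous_inv_one_add_sq).intervalIntegrable _ _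
  have i3 : IntervalIntegrable (fun x : ℝ => x * log (1 + x ^ 2) / (1 + x ^ 2)) volume 0 1 :=
    ((continuous_id.mul continuous_log_one_add_sq).mul
      continuous_inv_one_add_sq).intervalIntegrable _ _
  have h := intervalIntegral.integral_sub (i1.add i2) i3
  rw [intervalIntegral.integral_add i1 i2, integral_log_one_add_sq_div_one_add,
    integral_log_one_add_sq_div_one_add_sq, integral_mul_log_one_add_sq_div_one_add_sq] at h
  rw [show 1 / 2 * log 2 ^ 2 - π ^ 2 / 48 + π / 2 * log 2 - catalanG =
    3 / 4 * log 2 ^ 2 - π ^ 2 / 48 + (π / 2 * log 2 - catalanG) - log 2 ^ 2 / 4 by ring, ← h,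
    ← intervalIntegral.integral_const_mul]
  refine intervalIntegral.integral_congr_Ioo_of_le zero_le_one fun x hx => ?_
  have h0 : 1 + x ≠ 0 := by linarith [hx.1]
  have h1 : 1 + x ^ 2 ≠ 0 := by positivity
  field_simp
  ring
end

section
/- For every real x with 0 < x ≤ 1, ∫_0^x u² / ((1+u²)(u+x)) du = (x²/(1+x²)) ln 2 + ln(1+x²)/(2(1+x²)) − x (arctan x)/(1+x²). -/
/-- An antiderivative of `u ^ 2 / ((1 + u ^ 2) * (u + x))`, from its partial fractions. -/
theorem hasDerivAt_antideriv_sq_div {x u : ℝ} (h : u + x ≠ 0) :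
    HasDerivAt (fun u : ℝ => x ^ 2 / (1 + x ^ 2) * Real.log (u + x) +
        1 / (2 * (1 + x ^ 2)) * Real.log (1 + u ^ 2) - x / (1 + x ^ 2) * Real.arctan u)
      (u ^ 2 / ((1 + u ^ 2) * (u + x))) u := by
  have hu : 1 + u ^ 2 ≠ 0 := by positivity
  have hx : 1 + x ^ 2 ≠ 0 := by positivity
  have h₁ := (((hasDerivAt_id u).add_const x).log h).const_mul (x ^ 2 / (1 + x ^ 2))
  have h₂ := (((hasDerivAt_pow 2 u).const_add 1).log hu).const_mul (1 / (2 * (1 + x ^ 2)))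
  have h₃ := (Real.hasDerivAt_arctan u).const_mul (x / (1 + x ^ 2))
  refine ((h₁.add h₂).sub h₃).congr_deriv ?_
  simp only [id]
  field_simp
  ring

theorem stmt_14 (x : ℝ) (hx0 : 0 < x) (hx1 : x ≤ 1) :
    ∫ u in (0 : ℝ)..x, u ^ 2 / ((1 + u ^ 2) * (u + x)) =
      x ^ 2 / (1 + x ^ 2) * Real.log 2 + Real.log (1 + x ^ 2) / (2 * (1 + x ^ 2)) -
        x * Real.arctan x / (1 + x ^ 2) := by
  have hpos : ∀ u ∈ Set.uIcc 0 x, u + x ≠ 0 := fun u hu => by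
    rw [Set.uIcc_of_le hx0.le] at hu
    linarith [hu.1]
  rw [intervalIntegral.integral_eq_sub_of_hasDerivAt
    (fun u hu => hasDerivAt_antideriv_sq_div (hpos u hu))]
  · rw [← two_mul, Real.log_mul two_ne_zero hx0.ne']
    simp only [zero_add, Real.arctan_zero, ne_eq, OfNat.ofNat_ne_zero, not_false_eq_true,
      zero_pow, add_zero, Real.log_one]
    ring
  · refine ContinuousOn.intervalIntegrable (ContinuousOn.div (by fun_prop) (by fun_prop) ?_)
    exact fun u hu => mul_ne_zero (by positivity) (hpos u hu)
end
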